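/- For an ultrametric space M the following are equivalent: (i) M is T-complete and homogeneous; (ii) M is T-complete and satisfies property h; (iii) M is isometric to M_s(Well(V)) for some V ⊆ ℝ⁺ with 0 ∈ V and some function s assigning to each r ∈ V* a cardinal s(r) ≥ 2. -/

import Mathlib

universe u

open Cardinal

/-- A point of the space `M_s(J)`: a function `f` defined on `V* = V \ {0}` such that
`f r` is an element of the cardinal `s r` (viewed as an initial ordinal), whose support
`{r ∈ V* | f r ≠ 0}` belongs to the collection `J`.  (The function is extended by `0`
outside `V*`.) -/
structure MsPoint (V : Set ℝ) (s : ℝ → Cardinal.{u}) (J : Set (Set ℝ)) :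
    Type (u + 1) where
  toFun : ℝ → Ordinal.{u}
  lt_ord : ∀ r ∈ V \ {0}, toFun r < (s r).ord
  eq_zero : ∀ r ∉ V \ {0}, toFun r = 0
  supp_mem : {r | r ∈ V \ {0} ∧ toFun r ≠ 0} ∈ J

/-- The ultrametric distance on `M_s(J)`:
`d(f, g) = sup {r ∈ V* | f r ≠ g r}` (with `sup ∅ = 0`). -/
noncomputable def msDist {V : Set ℝ} {s : ℝ → Cardinal.{u}} {J : Set (Set ℝ)}
    (f g : MsPoint V s J) : ℝ :=
  sSup {r | r ∈ V \ {0} ∧ f.toFun r ≠ g.toFun r}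

/-- `Bound(V)`: the subsets of `V* = V \ {0}` which are bounded above in `ℝ`. -/
def BoundSets (V : Set ℝ) : Set (Set ℝ) := {A | A ⊆ V \ {0} ∧ BddAbove A}

/-- `Fin(V)`: the finite subsets of `V* = V \ {0}`. -/
def FinSets (V : Set ℝ) : Set (Set ℝ) := {A | A ⊆ V \ {0} ∧ A.Finite}

/-- `Well(V)`: the subsets of `V* = V \ {0}` which are well-ordered under `≥`
(equivalently, on which `>` is well-founded). -/
def WellSets (V : Set ℝ) : Set (Set ℝ) :=
  {A | A ⊆ V \ {0} ∧ A.WellFoundedOn (· > · : ℝ → ℝ → Prop)}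

section Defs

open Metric

variable (M : Type u) [MetricSpace M]

/-- A metric space is homogeneous if every isometry between two finite subsets of it
extends to a surjective isometry of the whole space onto itself. -/
def IsHomogeneous : Prop :=
  ∀ F : Set M, F.Finite → ∀ φ : M → M,
    (∀ x ∈ F, ∀ y ∈ F, dist (φ x) (φ y) = dist x y) →
    ∃ ψ : M ≃ᵢ M, ∀ x ∈ F, ψ x = φ x

/-- The balls of `M`: open balls and closed balls of non-negative radius. -/
def ballsOf : Set (Set M) :=
  {B | ∃ (a : M) (r : ℝ), 0 ≤ r ∧ (B = ball a r ∨ B = closedBall a r)}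

/-- `M` is T-complete: the intersection of every chain of non-empty balls of `M` is
non-empty. -/
def TComplete : Prop :=
  ∀ C : Set (Set M), C ⊆ ballsOf M → (∀ B ∈ C, B.Nonempty) →
    IsChain (· ⊆ ·) C → (⋂₀ C).Nonempty

/-- The spectrum of a point `a`: the set of distances from `a` to points of the space. -/
def specAt (a : M) : Set ℝ := Set.range (dist a)

/-- The nerve of `M`: closed balls `B̂(a, r)` with `a ∈ M` and `r ∈ Spec(M, a)`. -/
def nerv : Set (Set M) := {B | ∃ (a : M) (r : ℝ), r ∈ specAt M a ∧ B = closedBall a r}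

/-- The sons of a set `B`: the open balls of radius `δ(B)` contained in `B`. -/
def sons (B : Set M) : Set (Set M) :=
  {S | (∃ a : M, S = ball a (Metric.diam B)) ∧ S ⊆ B}

/-- Property `h`: all points of `M` have the same spectrum, and any two members of the
nerve of the same diameter have the same number of sons. -/
def PropH : Prop :=
  (∀ x x' : M, specAt M x = specAt M x') ∧
    ∀ B ∈ nerv M, ∀ B' ∈ nerv M, Metric.diam B = Metric.diam B' →
      Cardinal.mk (sons M B) = Cardinal.mk (sons M B')

/-- `M` is isometric to a space of the form `M_s(Well(V))`. -/
def IsometricToMsWell : Prop :=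
  ∃ (V : Set ℝ) (s : ℝ → Cardinal.{u}), V ⊆ {r : ℝ | 0 ≤ r} ∧ (0 : ℝ) ∈ V ∧
    (∀ r ∈ V \ {0}, 2 ≤ s r) ∧
    ∃ e : M ≃ MsPoint V s (WellSets V), ∀ x y : M, msDist (e x) (e y) = dist x y

end Defs

section Homogeneous

open Metric

variable {M : Type u} [MetricSpace M]

lemma exists_isometryEquiv_fixing_equidistant [IsUltrametricDist M]
    (htrans : ∀ a b : M, ∃ ψ : M ≃ᵢ M, ψ a = b) (b b' : M) :
    ∃ σ : M ≃ᵢ M, σ b = b' ∧ ∀ y, dist b y = dist b' y → σ y = y := by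
  classical
  have ultra : ∀ x y z : M, dist x z ≤ max (dist x y) (dist y z) := dist_triangle_max
  rcases eq_or_ne b b' with rfl | hne
  · exact ⟨IsometryEquiv.refl M, rfl, fun _ _ => rfl⟩
  obtain ⟨τ, hτ⟩ := htrans b b'
  have hr : 0 < dist b b' := dist_pos.2 hne
  set r := dist b b' with hrdef
  have hfwd : ∀ y, dist b' (τ y) = dist b y := fun y => by rw [← hτ, τ.dist_eq]
  have hbwd : ∀ y, dist b (τ.symm y) = dist b' y := fun y => by
    rw [← hfwd, τ.apply_symm_apply]
  have hdisj : ∀ y, dist b' y < r → ¬ dist b y < r := fun y h h' =>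
    absurd (ultra b y b') (not_le.2 (max_lt h' (by rwa [dist_comm])))
  let σ : M → M := fun y =>
    if dist b y < r then τ y else if dist b' y < r then τ.symm y else y
  have h₁ : ∀ y, dist b y < r → σ y = τ y := fun y h => if_pos h
  have h₂ : ∀ y, dist b' y < r → σ y = τ.symm y := fun y h => by
    simp only [σ, if_neg (hdisj y h), if_pos h]
  have h₃ : ∀ y, ¬ dist b y < r → ¬ dist b' y < r → σ y = y := fun y h h' => by
    simp only [σ, if_neg h, if_neg h']
  have hinv : Function.Involutive σ := by
    intro y
    by_cases h : dist b y < r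
    · rw [h₁ y h, h₂ _ (by rwa [hfwd]), τ.symm_apply_apply]
    by_cases h' : dist b' y < r
    · rw [h₂ y h', h₁ _ (by rwa [hbwd]), τ.apply_symm_apply]
    · rw [h₃ y h h', h₃ y h h']
  have hcross : ∀ y z, dist b y < r → dist b' z < r → dist y z = r := by
    intro y z hy hz
    have e₁ := ultra b y b'
    have e₂ := ultra y z b'
    have e₃ := ultra y b z
    have e₄ := ultra b b' z
    rw [dist_comm z b'] at e₂
    rw [dist_comm y b] at e₃
    grind
  have hout : ∀ y z, ¬ dist b z < r → ¬ dist b' z < r → dist b y < r →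
      dist y z = dist (τ y) z := by
    intro y z h h' hy
    have e₀ := hfwd y
    have e₁ := ultra y b z
    have e₂ := ultra b y z
    have e₃ := ultra (τ y) b' z
    have e₄ := ultra b' (τ y) z
    have e₅ := ultra b b' z
    have e₆ := ultra b' b z
    rw [dist_comm y b] at e₁
    rw [dist_comm (τ y) b'] at e₃
    rw [dist_comm b' b] at e₆
    grind
  have hout' : ∀ y z, ¬ dist b z < r → ¬ dist b' z < r → dist b' y < r →
      dist y z = dist (τ.symm y) z := by
    intro y z h h' hy
    have := hout (τ.symm y) z h h' (by rwa [hbwd])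
    rw [this, τ.apply_symm_apply]
  have hσ : Isometry σ := by
    refine Isometry.of_dist_eq fun y z => ?_
    by_cases hy : dist b y < r
    · rw [h₁ y hy]
      by_cases hz : dist b z < r
      · rw [h₁ z hz, τ.dist_eq]
      by_cases hz' : dist b' z < r
      · rw [h₂ z hz', hcross y z hy hz', dist_comm,
          hcross _ _ (by rwa [hbwd]) (by rwa [hfwd])]
      · rw [h₃ z hz hz', hout y z hz hz' hy]
    by_cases hy' : dist b' y < r
    · rw [h₂ y hy']
      by_cases hz : dist b z < r
      · rw [h₁ z hz, dist_comm y z, hcross z y hz hy',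
          hcross _ _ (by rwa [hbwd]) (by rwa [hfwd])]
      by_cases hz' : dist b' z < r
      · rw [h₂ z hz', τ.symm.dist_eq]
      · rw [h₃ z hz hz', hout' y z hz hz' hy']
    · rw [h₃ y hy hy']
      by_cases hz : dist b z < r
      · rw [h₁ z hz, dist_comm, dist_comm y, hout z y hy hy' hz]
      by_cases hz' : dist b' z < r
      · rw [h₂ z hz', dist_comm, dist_comm y, hout' z y hy hy' hz']
      · rw [h₃ z hz hz']
  refine ⟨⟨hinv.toPerm, hσ⟩, ?_, fun y hy => ?_⟩
  · change σ b = b'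
    rw [h₁ b (by rwa [dist_self]), hτ]
  · have hfar : ¬ dist b' y < r := fun h => hdisj y h (hy ▸ h)
    exact h₃ y (hy ▸ hfar) hfar

/-- An ultrametric space whose isometry group is transitive is homogeneous. -/
lemma isHomogeneous_of_transitive [IsUltrametricDist M]
    (htrans : ∀ a b : M, ∃ ψ : M ≃ᵢ M, ψ a = b) : IsHomogeneous M := by
  intro F hF φ hφ
  induction F, hF using Set.Finite.induction_on with
  | empty => exact ⟨IsometryEquiv.refl M, fun x hx => hx.elim⟩
  | @insert a F _ _ ih =>
    obtain ⟨ψ, hψ⟩ := ih fun x hx y hy =>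
      hφ x (Set.mem_insert_of_mem _ hx) y (Set.mem_insert_of_mem _ hy)
    obtain ⟨σ, hσ, hfix⟩ := exists_isometryEquiv_fixing_equidistant htrans (ψ a) (φ a)
    refine ⟨ψ.trans σ, fun x hx => ?_⟩
    rcases hx with rfl | hx
    · exact hσ
    · change σ (ψ x) = φ x
      rw [hfix, hψ x hx]
      rw [ψ.dist_eq, hψ x hx, hφ a (Set.mem_insert _ _) x (Set.mem_insert_of_mem _ hx)]

lemma IsHomogeneous.exists_apply_eq (h : IsHomogeneous M) (a b : M) :
    ∃ ψ : M ≃ᵢ M, ψ a = b := by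
  obtain ⟨ψ, hψ⟩ := h {a} (Set.finite_singleton a) (fun _ => b) (by simp)
  exact ⟨ψ, hψ a rfl⟩

lemma diam_closedBall_of_mem_specAt [IsUltrametricDist M] {a : M} {r : ℝ}
    (h : r ∈ specAt M a) : Metric.diam (closedBall a r) = r := by
  obtain ⟨b, rfl⟩ := h
  apply le_antisymm
  · refine Metric.diam_le_of_forall_dist_le dist_nonneg fun x hx y hy => ?_
    refine (dist_triangle_max x a y).trans (max_le hx ?_)
    rw [dist_comm]
    exact hy
  · exact Metric.dist_le_diam_of_mem Metric.isBounded_closedBall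
      (mem_closedBall_self dist_nonneg) (by rw [mem_closedBall, dist_comm])

lemma IsHomogeneous.propH [IsUltrametricDist M] (h : IsHomogeneous M) : PropH M := by
  refine ⟨fun x x' => ?_, ?_⟩
  · obtain ⟨ψ, rfl⟩ := h.exists_apply_eq x x'
    ext r
    constructor
    · rintro ⟨y, rfl⟩
      exact ⟨ψ y, ψ.dist_eq x y⟩
    · rintro ⟨y, rfl⟩
      exact ⟨ψ.symm y, by rw [← ψ.dist_eq, ψ.apply_symm_apply]⟩
  · rintro B ⟨a, r, hr, rfl⟩ B' ⟨a', r', hr', rfl⟩ hd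
    rw [diam_closedBall_of_mem_specAt hr, diam_closedBall_of_mem_specAt hr'] at hd
    subst hd
    obtain ⟨ψ, rfl⟩ := h.exists_apply_eq a a'
    have himage : sons M (closedBall (ψ a) r) = Set.image ψ '' sons M (closedBall a r) := by
      simp only [sons, diam_closedBall_of_mem_specAt hr, diam_closedBall_of_mem_specAt hr']
      ext S
      constructor
      · rintro ⟨⟨b, rfl⟩, hS⟩
        refine ⟨ball (ψ.symm b) r, ⟨⟨_, rfl⟩, ?_⟩, by
          rw [ψ.image_ball, ψ.apply_symm_apply]⟩
        rwa [← Set.image_subset_image_iff ψ.injective, ψ.image_ball, ψ.image_closedBall,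
          ψ.apply_symm_apply]
      · rintro ⟨_, ⟨⟨b, rfl⟩, hS⟩, rfl⟩
        refine ⟨⟨ψ b, ψ.image_ball b r⟩, ?_⟩
        rw [← ψ.image_closedBall]
        exact Set.image_mono hS
    rw [himage, Cardinal.mk_image_eq ψ.injective.image_injective]

end Homogeneous

section MsSpace

variable {V : Set ℝ} {s : ℝ → Cardinal.{u}}

@[ext]
lemma MsPoint.ext {J : Set (Set ℝ)} {f g : MsPoint V s J} (h : f.toFun = g.toFun) : f = g := by
  cases f
  cases g
  cases h
  rfl

/-- A nonempty subset of `ℝ` which is well-ordered under `≥` has a greatest element. -/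
lemma exists_isGreatest_of_wellFoundedOn_gt {A : Set ℝ}
    (hA : A.WellFoundedOn (· > · : ℝ → ℝ → Prop)) (hne : A.Nonempty) :
    ∃ r, IsGreatest A r := by
  obtain ⟨x, hx⟩ := hne
  obtain ⟨m, -, hm⟩ := WellFounded.has_min hA Set.univ ⟨⟨x, hx⟩, trivial⟩
  exact ⟨m, m.2, fun y hy => not_lt.1 (hm ⟨y, hy⟩ trivial)⟩

/-- If all the upper sections of `S` are well-ordered under `≥`, then so is `S`. -/
lemma wellFoundedOn_gt_of_upper_sections {S : Set ℝ}
    (h : ∀ t ∈ S, (S ∩ Set.Ici t).WellFoundedOn (· > · : ℝ → ℝ → Prop)) :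
    S.WellFoundedOn (· > · : ℝ → ℝ → Prop) := by
  rw [Set.WellFoundedOn, WellFounded.wellFounded_iff_has_min]
  rintro A ⟨x, hx⟩
  obtain ⟨m, hm⟩ := exists_isGreatest_of_wellFoundedOn_gt
    ((h x x.2).subset (s := Subtype.val '' A ∩ Set.Ici x.1) (by
      rintro _ ⟨⟨y, _, rfl⟩, hy⟩
      exact ⟨y.2, hy⟩)) ⟨x, ⟨x, hx, rfl⟩, Set.self_mem_Ici⟩
  obtain ⟨⟨⟨m, hmA, rfl⟩, hxm⟩, hmax⟩ := hm
  refine ⟨m, hmA, fun y hy hlt => ?_⟩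
  exact absurd (hmax ⟨⟨y, hy, rfl⟩, hxm.trans (le_of_lt hlt)⟩) (not_le.2 hlt)

lemma wellFoundedOn_ne (f g : MsPoint V s (WellSets V)) :
    {r | r ∈ V \ {0} ∧ f.toFun r ≠ g.toFun r}.WellFoundedOn (· > · : ℝ → ℝ → Prop) := by
  refine (f.supp_mem.2.union g.supp_mem.2).subset ?_
  rintro r ⟨hr, hne⟩
  by_cases h : f.toFun r = 0
  · exact Or.inr ⟨hr, fun h' => hne (h.trans h'.symm)⟩
  · exact Or.inl ⟨hr, h⟩

lemma exists_isGreatest_ne {f g : MsPoint V s (WellSets V)} (h : f ≠ g) :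
    ∃ r, IsGreatest {r | r ∈ V \ {0} ∧ f.toFun r ≠ g.toFun r} r := by
  refine exists_isGreatest_of_wellFoundedOn_gt (wellFoundedOn_ne f g) ?_
  by_contra hempty
  rw [Set.not_nonempty_iff_eq_empty] at hempty
  refine h (MsPoint.ext (funext fun r => ?_))
  by_cases hr : r ∈ V \ {0}
  · by_contra hne
    exact Set.eq_empty_iff_forall_notMem.1 hempty r ⟨hr, hne⟩
  · rw [f.eq_zero r hr, g.eq_zero r hr]

lemma msDist_self (f : MsPoint V s (WellSets V)) : msDist f f = 0 := by
  simp [msDist]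

lemma mem_of_toFun_ne {f g : MsPoint V s (WellSets V)} {t : ℝ} (h : f.toFun t ≠ g.toFun t) :
    t ∈ V \ {0} := by
  by_contra ht
  exact h ((f.eq_zero t ht).trans (g.eq_zero t ht).symm)

lemma msDist_le_iff {f g : MsPoint V s (WellSets V)} {r : ℝ} (hr : 0 ≤ r) :
    msDist f g ≤ r ↔ ∀ t, r < t → f.toFun t = g.toFun t := by
  rcases eq_or_ne f g with rfl | hne
  · simp [msDist_self, hr]
  obtain ⟨m, hm⟩ := exists_isGreatest_ne hne
  rw [msDist, hm.csSup_eq]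
  refine ⟨fun h t ht => ?_, fun h => ?_⟩
  · by_contra htne
    exact absurd (hm.2 ⟨mem_of_toFun_ne htne, htne⟩) (not_le.2 (h.trans_lt ht))
  · by_contra hlt
    exact hm.1.2 (h m (not_le.1 hlt))

lemma msDist_lt_iff {f g : MsPoint V s (WellSets V)} {r : ℝ} (hr : 0 < r) :
    msDist f g < r ↔ ∀ t, r ≤ t → f.toFun t = g.toFun t := by
  rcases eq_or_ne f g with rfl | hne
  · simp [msDist_self, hr]
  obtain ⟨m, hm⟩ := exists_isGreatest_ne hne
  rw [msDist, hm.csSup_eq]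
  refine ⟨fun h t ht => ?_, fun h => ?_⟩
  · by_contra htne
    exact absurd (hm.2 ⟨mem_of_toFun_ne htne, htne⟩) (not_le.2 (h.trans_le ht))
  · by_contra hlt
    exact hm.1.2 (h m (not_lt.1 hlt))

/-- The pointwise transposition of the values of `f` and `f'`. -/
noncomputable def msSwap (f f' g : MsPoint V s (WellSets V)) : MsPoint V s (WellSets V) where
  toFun r := Equiv.swap (f.toFun r) (f'.toFun r) (g.toFun r)
  lt_ord r hr := by
    have h := f.lt_ord r hr
    have h' := f'.lt_ord r hr
    have hg := g.lt_ord r hr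
    rw [Equiv.swap_apply_def]
    split_ifs <;> assumption
  eq_zero r hr := by simp [f.eq_zero r hr, f'.eq_zero r hr, g.eq_zero r hr]
  supp_mem := by
    refine ⟨fun r hr => hr.1, ((f.supp_mem.2.union f'.supp_mem.2).union g.supp_mem.2).subset ?_⟩
    rintro r ⟨hr, hne⟩
    by_contra h
    simp only [Set.mem_union, Set.mem_ofPred_eq, not_or, not_and, not_not] at h
    exact hne (by simp [h.1.1 hr, h.1.2 hr, h.2 hr])

lemma msSwap_involutive (f f' : MsPoint V s (WellSets V)) :
    Function.Involutive (msSwap f f') := fun g => by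
  ext1
  funext r
  simp [msSwap]

lemma msSwap_left (f f' : MsPoint V s (WellSets V)) : msSwap f f' f = f' := by
  ext1
  funext r
  exact Equiv.swap_apply_left _ _

lemma msDist_msSwap (f f' g h : MsPoint V s (WellSets V)) :
    msDist (msSwap f f' g) (msSwap f f' h) = msDist g h := by
  simp only [msDist, msSwap, ne_eq, EmbeddingLike.apply_eq_iff_eq]

end MsSpace

section FromMs

open Metric

variable {M : Type u} [MetricSpace M] {V : Set ℝ} {s : ℝ → Cardinal.{u}}

lemma exists_isometryEquiv_apply_eq_of_msEquiv (e : M ≃ MsPoint V s (WellSets V))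
    (he : ∀ x y, msDist (e x) (e y) = dist x y) (a b : M) : ∃ ψ : M ≃ᵢ M, ψ a = b := by
  refine ⟨⟨(e.trans (msSwap_involutive (e a) (e b)).toPerm).trans e.symm,
    Isometry.of_dist_eq fun x y => ?_⟩, ?_⟩
  · rw [← he, ← he x y, ← msDist_msSwap (e a) (e b) (e x) (e y)]
    simp
  · change e.symm (msSwap (e a) (e b) (e a)) = b
    rw [msSwap_left, e.symm_apply_apply]

lemma tComplete_of_msEquiv (hs : ∀ r ∈ V \ {0}, 2 ≤ s r) (e : M ≃ MsPoint V s (WellSets V))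
    (he : ∀ x y, msDist (e x) (e y) = dist x y) : TComplete M := by
  classical
  intro C hC hne hchain
  let c : M → ℝ → Ordinal.{u} := fun x => (e x).toFun
  have hle : ∀ {x y : M} {r : ℝ}, 0 ≤ r → (dist x y ≤ r ↔ ∀ t, r < t → c x t = c y t) :=
    fun hr => by rw [← he]; exact msDist_le_iff hr
  have hlt : ∀ {x y : M} {r : ℝ}, 0 < r → (dist x y < r ↔ ∀ t, r ≤ t → c x t = c y t) :=
    fun hr => by rw [← he]; exact msDist_lt_iff hr
  -- `y` is a point of a member of `C` all of whose points agree from `t` on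
  let P : ℝ → M → Prop := fun t y =>
    ∃ B ∈ C, y ∈ B ∧ ∀ z ∈ B, ∀ t', t ≤ t' → c z t' = c y t'
  have hPmono : ∀ {t t' y}, P t y → t ≤ t' → P t' y := by
    rintro t t' y ⟨B, hB, hy, h⟩ htt'
    exact ⟨B, hB, hy, fun z hz t'' ht'' => h z hz t'' (htt'.trans ht'')⟩
  have hPeq : ∀ {t y y'}, P t y → P t y' → c y t = c y' t := by
    rintro t y y' ⟨B, hB, hy, h⟩ ⟨B', hB', hy', h'⟩
    rcases hchain.total hB hB' with hsub | hsub
    · exact h' y (hsub hy) t le_rfl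
    · exact (h y' (hsub hy') t le_rfl).symm
  let F : ℝ → Ordinal.{u} := fun t => if h : ∃ y, P t y then c h.choose t else 0
  have hF : ∀ {t y}, P t y → F t = c y t := by
    intro t y h
    have hex : ∃ y, P t y := ⟨y, h⟩
    simp only [F, dif_pos hex]
    exact hPeq hex.choose_spec h
  have hF0 : ∀ {t}, (¬ ∃ y, P t y) → F t = 0 := fun h => dif_neg h
  let f : MsPoint V s (WellSets V) :=
    { toFun := F
      lt_ord := fun r hr => by
        by_cases h : ∃ y, P r y
        · obtain ⟨y, hy⟩ := h
          rw [hF hy]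
          exact (e y).lt_ord r hr
        · rw [hF0 h, ← Cardinal.ord_zero, Cardinal.ord_lt_ord]
          exact zero_lt_two.trans_le (hs r hr)
      eq_zero := fun r hr => by
        by_cases h : ∃ y, P r y
        · obtain ⟨y, hy⟩ := h
          rw [hF hy]
          exact (e y).eq_zero r hr
        · exact hF0 h
      supp_mem := by
        refine ⟨fun r hr => hr.1, wellFoundedOn_gt_of_upper_sections ?_⟩
        rintro t ⟨ht, htne⟩
        obtain ⟨y, hy⟩ : ∃ y, P t y := by
          by_contra h
          exact htne (hF0 h)
        refine (e y).supp_mem.2.subset ?_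
        rintro t' ⟨⟨ht', hne'⟩, htt'⟩
        exact ⟨ht', by rwa [hF (hPmono hy htt')] at hne'⟩ }
  have hcf : c (e.symm f) = F := by simp [c, f]
  refine ⟨e.symm f, fun B hB => ?_⟩
  obtain ⟨a, r, hr, rfl | rfl⟩ := hC hB
  · have hr' : 0 < r := nonempty_ball.1 (hne _ hB)
    rw [mem_ball, hlt hr', hcf]
    intro t ht
    exact hF ⟨_, hB, mem_ball_self hr', fun z hz t' ht' =>
      (hlt hr').1 hz t' (ht.trans ht')⟩
  · rw [mem_closedBall, hle hr, hcf]
    intro t ht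
    exact hF ⟨_, hB, mem_closedBall_self hr, fun z hz t' ht' =>
      (hle hr).1 hz t' (ht.trans_le ht')⟩

end FromMs

section ToMs

open Metric

/-- The elements of a type can be enumerated by the initial ordinal of its cardinality, with a
given element coming first. -/
lemma exists_injective_range_eq_Iio_ord {α : Type u} (a : α) :
    ∃ l : α → Ordinal.{u}, Function.Injective l ∧ Set.range l = Set.Iio (#α).ord ∧ l a = 0 := by
  classical
  have hα : 0 < (#α).ord := by
    rw [← Cardinal.ord_zero, Cardinal.ord_lt_ord]
    exact pos_iff_ne_zero.2 (Cardinal.mk_ne_zero_iff.2 ⟨a⟩)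
  have hcard : Cardinal.lift.{u + 1} #α = Cardinal.lift.{u} #(Set.Iio (#α).ord) := by
    rw [Cardinal.mk_Iio_ordinal, Cardinal.card_ord, Cardinal.lift_id'.{u, u + 1}]
  obtain ⟨E⟩ := Cardinal.lift_mk_eq'.1 hcard
  let E' : α ≃ Set.Iio (#α).ord := E.trans (Equiv.swap (E a) ⟨0, hα⟩)
  refine ⟨fun x => (E' x).1, Subtype.val_injective.comp E'.injective, ?_, ?_⟩
  · change Set.range (Subtype.val ∘ E') = _
    rw [E'.surjective.range_comp, Subtype.range_val]
  · simp [E']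

variable {M : Type u} [MetricSpace M]

lemma mem_sons_closedBall [IsUltrametricDist M] {a : M} {r : ℝ} (hr : r ∈ specAt M a)
    (hpos : 0 < r) {S : Set M} :
    S ∈ sons M (closedBall a r) ↔ ∃ x ∈ closedBall a r, S = ball x r := by
  simp only [sons, diam_closedBall_of_mem_specAt hr]
  constructor
  · rintro ⟨⟨x, rfl⟩, hS⟩
    exact ⟨x, hS (mem_ball_self hpos), rfl⟩
  · rintro ⟨x, hx, rfl⟩
    refine ⟨⟨x, rfl⟩, ?_⟩
    rw [IsUltrametricDist.closedBall_eq_of_mem hx]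
    exact ball_subset_closedBall

lemma PropH.isometricToMsWell [IsUltrametricDist M] (hT : TComplete M) (hH : PropH M) :
    IsometricToMsWell M := by
  classical
  obtain ⟨x₀, -⟩ := hT ∅ (Set.empty_subset _) (fun _ h => h.elim) (IsChain.empty)
  set V : Set ℝ := specAt M x₀ with hV
  let s : ℝ → Cardinal.{u} := fun r => #(sons M (closedBall x₀ r))
  have hspec : ∀ {r} (x : M), r ∈ V \ {0} → r ∈ specAt M x := fun x hr => by
    rw [hH.1 x x₀]
    exact hr.1
  have hpos : ∀ {r}, r ∈ V \ {0} → 0 < r := by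
    rintro r ⟨⟨y, rfl⟩, h0⟩
    exact lt_of_le_of_ne dist_nonneg (Ne.symm h0)
  have hdistV : ∀ {x y : M}, x ≠ y → dist x y ∈ V \ {0} := fun {x y} h =>
    ⟨by rw [hV, hH.1 x₀ x]; exact ⟨y, rfl⟩, (dist_pos.2 h).ne'⟩
  have hsons : ∀ {r} (x : M), r ∈ V \ {0} → #(sons M (closedBall x r)) = s r := by
    intro r x hr
    refine hH.2 _ ⟨x, r, hspec x hr, rfl⟩ _ ⟨x₀, r, hr.1, rfl⟩ ?_
    rw [diam_closedBall_of_mem_specAt (hspec x hr), diam_closedBall_of_mem_specAt hr.1]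
  obtain ⟨_, _⟩ := exists_wellFoundedLT M
  -- the least point of each nonempty subset
  have hmin : ∀ B : Set M, ∃ m, B.Nonempty → m ∈ B ∧ ∀ y ∈ B, m ≤ y := by
    intro B
    by_cases h : B.Nonempty
    · obtain ⟨m, hm, hm'⟩ := (wellFounded_lt (α := M)).has_min B h
      exact ⟨m, fun _ => ⟨hm, fun y hy => not_lt.1 (hm' y hy)⟩⟩
    · exact ⟨x₀, fun h' => (h h').elim⟩
  choose m hm using hmin
  -- the labelling of the sons of a ball
  have hlabel : ∀ (r : ℝ) (B : Set M), ∃ l : Set M → Ordinal.{u},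
      r ∈ V \ {0} → (∃ x, B = closedBall x r) →
        Set.InjOn l (sons M B) ∧ l '' sons M B = Set.Iio (s r).ord ∧ l (ball (m B) r) = 0 := by
    intro r B
    by_cases h : r ∈ V \ {0} ∧ ∃ x, B = closedBall x r
    · obtain ⟨hr, x, rfl⟩ := h
      have hmem := (hm (closedBall x r) ⟨x, mem_closedBall_self (hpos hr).le⟩).1
      have hson : ball (m (closedBall x r)) r ∈ sons M (closedBall x r) :=
        (mem_sons_closedBall (hspec x hr) (hpos hr)).2 ⟨_, hmem, rfl⟩
      obtain ⟨l, hinj, hrange, h0⟩ := exists_injective_range_eq_Iio_ord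
        (⟨_, hson⟩ : sons M (closedBall x r))
      refine ⟨fun S => if hS : S ∈ sons M (closedBall x r) then l ⟨S, hS⟩ else 0,
        fun _ _ => ⟨fun S hS S' hS' heq => ?_, ?_, ?_⟩⟩
      · simp only [dif_pos hS, dif_pos hS'] at heq
        exact congrArg Subtype.val (hinj heq)
      · rw [← hsons x hr, ← hrange]
        ext o
        constructor
        · rintro ⟨S, hS, rfl⟩
          exact ⟨⟨S, hS⟩, by simp only [dif_pos hS]⟩
        · rintro ⟨⟨S, hS⟩, rfl⟩
          exact ⟨S, hS, by simp only [dif_pos hS]⟩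
      · simp only [dif_pos hson, h0]
    · exact ⟨fun _ => 0, fun h₁ h₂ => (h ⟨h₁, h₂⟩).elim⟩
  choose l hl using hlabel
  let c : M → ℝ → Ordinal.{u} := fun x r =>
    if r ∈ V \ {0} then l r (closedBall x r) (ball x r) else 0
  have hc : ∀ {x r}, r ∈ V \ {0} → c x r = l r (closedBall x r) (ball x r) :=
    fun hr => if_pos hr
  have hc0 : ∀ {x r}, r ∉ V \ {0} → c x r = 0 := fun hr => if_neg hr
  have hball : ∀ {x r}, r ∈ V \ {0} → ∀ y ∈ closedBall x r,
      ball y r ∈ sons M (closedBall x r) :=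
    fun hr y hy => (mem_sons_closedBall (hspec _ hr) (hpos hr)).2 ⟨y, hy, rfl⟩
  have hcagree : ∀ {x y : M} {t : ℝ}, dist x y < t → c x t = c y t := by
    intro x y t h
    by_cases ht : t ∈ V \ {0}
    · rw [hc ht, hc ht, IsUltrametricDist.ball_eq_of_mem (mem_ball.2 h),
        IsUltrametricDist.closedBall_eq_of_mem (mem_closedBall.2 h.le)]
    · rw [hc0 ht, hc0 ht]
  have hcne : ∀ {x y : M}, x ≠ y → c x (dist x y) ≠ c y (dist x y) := by
    intro x y hne heq
    have hr := hdistV hne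
    have hy : y ∈ closedBall x (dist x y) := by rw [mem_closedBall, dist_comm]
    rw [hc hr, hc hr, ← IsUltrametricDist.closedBall_eq_of_mem hy] at heq
    have hx := mem_closedBall_self (x := x) (hpos hr).le
    have hbb := (hl _ _ hr ⟨x, rfl⟩).1 (hball hr x hx) (hball hr y hy) heq
    have : x ∈ ball y (dist x y) := hbb ▸ mem_ball_self (hpos hr)
    exact lt_irrefl _ (mem_ball.1 this)
  have hsupp : ∀ x, {r | r ∈ V \ {0} ∧ c x r ≠ 0} ∈ WellSets V := by
    intro x
    refine ⟨fun r hr => hr.1, ?_⟩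
    refine Subrelation.wf (r := InvImage (· < ·) fun r :
      {r | r ∈ V \ {0} ∧ c x r ≠ 0} => m (closedBall x r)) ?_ (InvImage.wf _ wellFounded_lt)
    rintro ⟨r, hr, hrne⟩ ⟨r', hr', hrne'⟩ hlt
    change r > r' at hlt
    change m (closedBall x r) < m (closedBall x r')
    have h₁ := hm (closedBall x r) ⟨x, mem_closedBall_self (hpos hr).le⟩
    have h₂ := hm (closedBall x r') ⟨x, mem_closedBall_self (hpos hr').le⟩
    refine lt_of_le_of_ne (h₁.2 _ (closedBall_subset_closedBall hlt.le h₂.1)) fun heq => hrne ?_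
    have hmem : m (closedBall x r) ∈ ball x r :=
      closedBall_subset_ball hlt (heq ▸ h₂.1)
    rw [hc hr, IsUltrametricDist.ball_eq_of_mem hmem]
    exact (hl r _ hr ⟨x, rfl⟩).2.2
  let E : M → MsPoint V s (WellSets V) := fun x =>
    { toFun := c x
      lt_ord := fun r hr => by
        have := (hl r _ hr ⟨x, rfl⟩).2.1
        rw [hc hr, ← Set.mem_Iio, ← this]
        exact ⟨_, hball hr x (mem_closedBall_self (hpos hr).le), rfl⟩
      eq_zero := fun r hr => hc0 hr
      supp_mem := hsupp x }
  have hE : ∀ x y, msDist (E x) (E y) = dist x y := by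
    intro x y
    rcases eq_or_ne x y with rfl | hne
    · rw [msDist_self, dist_self]
    · refine IsGreatest.csSup_eq ⟨⟨hdistV hne, hcne hne⟩, fun t ht => ?_⟩
      by_contra hlt
      exact ht.2 (hcagree (not_le.1 hlt))
  have hinj : Function.Injective E := fun x y h => by
    rw [← dist_eq_zero, ← hE, h, msDist_self]
  have hsurj : Function.Surjective E := by
    intro f
    let A : Set (M × ℝ) := {p | p.2 ∈ V \ {0} ∧ ∀ t, p.2 ≤ t → c p.1 t = f.toFun t}
    have hsub : ∀ p ∈ A, ∀ q ∈ A, p.2 ≤ q.2 → ball p.1 p.2 ⊆ ball q.1 q.2 := by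
      intro p hp q hq hpq
      have hmem : p.1 ∈ ball q.1 q.2 := by
        rw [mem_ball, ← hE, msDist_lt_iff (hpos hq.1)]
        intro t ht
        exact (hp.2 t (hpq.trans ht)).trans (hq.2 t ht).symm
      rw [IsUltrametricDist.ball_eq_of_mem hmem]
      exact ball_subset_ball hpq
    obtain ⟨z, hz⟩ := hT ((fun p : M × ℝ => ball p.1 p.2) '' A)
      (by
        rintro _ ⟨p, hp, rfl⟩
        exact ⟨p.1, p.2, (hpos hp.1).le, Or.inl rfl⟩)
      (by
        rintro _ ⟨p, hp, rfl⟩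
        exact nonempty_ball.2 (hpos hp.1))
      (by
        rintro _ ⟨p, hp, rfl⟩ _ ⟨q, hq, rfl⟩ _
        rcases le_total p.2 q.2 with h | h
        · exact Or.inl (hsub p hp q hq h)
        · exact Or.inr (hsub q hq p hp h))
    have hzA : ∀ p ∈ A, c z p.2 = f.toFun p.2 := by
      intro p hp
      have hzp : dist z p.1 < p.2 := hz _ ⟨p, hp, rfl⟩
      exact (hcagree hzp).trans (hp.2 _ le_rfl)
    refine ⟨z, ?_⟩
    by_contra hne
    obtain ⟨r, ⟨hr, hrne⟩, hmax⟩ := exists_isGreatest_ne hne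
    -- a point agreeing with `f` one step further than `z` does
    have hfr : f.toFun r ∈ l r (closedBall z r) '' sons M (closedBall z r) := by
      rw [(hl r _ hr ⟨z, rfl⟩).2.1]
      exact f.lt_ord r hr
    obtain ⟨S, hS, hSf⟩ := hfr
    obtain ⟨w, hw, rfl⟩ := (mem_sons_closedBall (hspec z hr) (hpos hr)).1 hS
    refine hrne (hzA (w, r) ⟨hr, fun t ht => ?_⟩)
    rcases eq_or_lt_of_le ht with rfl | hlt
    · change c w r = _
      rw [hc hr, ← IsUltrametricDist.closedBall_eq_of_mem hw, hSf]
    · change c w t = _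
      rw [hcagree ((mem_closedBall.1 hw).trans_lt hlt)]
      by_contra htne
      exact absurd (hmax ⟨mem_of_toFun_ne (f := E z) (g := f) htne, htne⟩) (not_le.2 hlt)
  refine ⟨V, s, ?_, ⟨x₀, dist_self x₀⟩, fun r hr => ?_, Equiv.ofBijective E ⟨hinj, hsurj⟩, hE⟩
  · rintro _ ⟨y, rfl⟩
    exact dist_nonneg
  · obtain ⟨y, rfl⟩ := hr.1
    have hy : y ∈ closedBall x₀ (dist x₀ y) := by rw [mem_closedBall, dist_comm]
    rw [Cardinal.two_le_iff]
    refine ⟨⟨_, hball hr x₀ (mem_closedBall_self dist_nonneg)⟩, ⟨_, hball hr y hy⟩, fun h => ?_⟩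
    have hbb : ball x₀ (dist x₀ y) = ball y (dist x₀ y) := congrArg Subtype.val h
    have : x₀ ∈ ball y (dist x₀ y) := hbb ▸ mem_ball_self (hpos hr)
    exact lt_irrefl _ (mem_ball.1 this)

end ToMs

/-- For an ultrametric space `M` the following are equivalent:
(i) `M` is T-complete and homogeneous; (ii) `M` is T-complete and satisfies property `h`;
(iii) `M` is isometric to `M_s(Well(V))` for some `V ⊆ ℝ⁺` with `0 ∈ V` and some
function `s` assigning to each `r ∈ V*` a cardinal `s r ≥ 2`. -/
theorem stmt12 (M : Type u) [MetricSpace M]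
    (ultra : ∀ x y z : M, dist x z ≤ max (dist x y) (dist y z)) :
    ((TComplete M ∧ IsHomogeneous M) ↔ (TComplete M ∧ PropH M)) ∧
      ((TComplete M ∧ PropH M) ↔ IsometricToMsWell M) := by
  have : IsUltrametricDist M := ⟨ultra⟩
  have hMs : IsometricToMsWell M → TComplete M ∧ IsHomogeneous M := by
    rintro ⟨V, s, -, -, hs, e, he⟩
    exact ⟨tComplete_of_msEquiv hs e he,
      isHomogeneous_of_transitive (exists_isometryEquiv_apply_eq_of_msEquiv e he)⟩
  have hH : TComplete M ∧ IsHomogeneous M → TComplete M ∧ PropH M := fun h => ⟨h.1, h.2.propH⟩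
  have hIso : TComplete M ∧ PropH M → IsometricToMsWell M := fun h => h.2.isometricToMsWell h.1
  exact ⟨⟨hH, hMs ∘ hIso⟩, ⟨hIso, hH ∘ hMs⟩⟩
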